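/- arXiv:1108.1555 — 2 statements merged into one kernel-verified Lean document; each statement's English description precedes it below -/
import Mathlib

section
/- For every multidegree m ∈ ℕ^n and every integer i with 0 ≤ i ≤ Σ_{k=1}^n d_k m_k, the dimension of the ℂ-vector space of polynomials f ∈ R of multidegree m satisfying D1(f) = 0 and E(f) = i·f equals the coefficient of z_1^{m_1}⋯z_n^{m_n} t^{(Σ_k d_k m_k) − i} in the formal power series (1 − t²)·Π_{k=1}^n Π_{j=0}^{d_k} (1 − z_k t^{2(d_k−j)})^{−1} ∈ ℤ[[z_1,…,z_n,t]]. -/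
open MvPolynomial

/-- Index type for the variables `v^{(k)}_j`, `1 ≤ k ≤ n`, `0 ≤ j ≤ d k`. -/
abbrev Idx (n : ℕ) (d : Fin n → ℕ) := Σ k : Fin n, Fin (d k + 1)

/-- The derivation `D1` with `D1 (v^{(k)}_j) = j • v^{(k)}_{j-1}`. -/
noncomputable def D1 (n : ℕ) (d : Fin n → ℕ) :
    Derivation ℂ (MvPolynomial (Idx n d) ℂ) (MvPolynomial (Idx n d) ℂ) :=
  mkDerivation ℂ (fun x =>
    if h : x.2.1 = 0 then 0
    else (x.2.1 : ℂ) • X ⟨x.1, ⟨x.2.1 - 1, by have := x.2.isLt; omega⟩⟩)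

/-- The derivation `D2` with `D2 (v^{(k)}_j) = (d k - j) • v^{(k)}_{j+1}`. -/
noncomputable def D2 (n : ℕ) (d : Fin n → ℕ) :
    Derivation ℂ (MvPolynomial (Idx n d) ℂ) (MvPolynomial (Idx n d) ℂ) :=
  mkDerivation ℂ (fun x =>
    if h : x.2.1 = d x.1 then 0
    else ((d x.1 - x.2.1 : ℕ) : ℂ) • X ⟨x.1, ⟨x.2.1 + 1, by have := x.2.isLt; omega⟩⟩)

/-- The derivation `E` with `E (v^{(k)}_j) = (d k - 2 j) • v^{(k)}_j`. -/
noncomputable def E (n : ℕ) (d : Fin n → ℕ) :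
    Derivation ℂ (MvPolynomial (Idx n d) ℂ) (MvPolynomial (Idx n d) ℂ) :=
  mkDerivation ℂ (fun x => ((d x.1 : ℂ) - 2 * (x.2.1 : ℂ)) • X x)

/-- The subspace of polynomials of multidegree `m`: every monomial has total degree
`m k` in the variables `v^{(k)}_0, …, v^{(k)}_{d k}`, for each `k`. -/
noncomputable def mdeg (n : ℕ) (d : Fin n → ℕ) (m : Fin n → ℕ) :
    Submodule ℂ (MvPolynomial (Idx n d) ℂ) where
  carrier := {f | ∀ α ∈ f.support, ∀ k : Fin n,
    (∑ j : Fin (d k + 1), α ⟨k, j⟩) = m k}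
  add_mem' := by
    intro f g hf hg α hα k
    rcases Finset.mem_union.mp (MvPolynomial.support_add hα) with h | h
    · exact hf α h k
    · exact hg α h k
  zero_mem' := by
    intro α hα k
    simp at hα
  smul_mem' := by
    intro c f hf α hα k
    exact hf α (MvPolynomial.support_smul hα) k

/-- `ω_d(m; i)`: the number of families of nonnegative integers
`(α^{(k)}_j)` with `∑_j α^{(k)}_j = m k` for each `k` and
`∑_{k,j} (d k - 2 j) ⬝ α^{(k)}_j = i`. -/
noncomputable def omegaCount (n : ℕ) (d : Fin n → ℕ) (m : Fin n → ℕ) (i : ℤ) : ℕ :=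
  Nat.card {α : Idx n d → ℕ //
    (∀ k : Fin n, (∑ j : Fin (d k + 1), α ⟨k, j⟩) = m k) ∧
    (∑ k : Fin n, ∑ j : Fin (d k + 1),
      ((d k : ℤ) - 2 * (j : ℕ)) * (α ⟨k, j⟩ : ℤ)) = i}

/-- The formal power series `∏_k ∏_j (1 - z_k t^{2(d_k - j)})⁻¹` in
`ℤ[[z_1, …, z_n, t]]` (variables indexed by `Fin n ⊕ Unit`, with `Sum.inl k ↦ z_k`
and `Sum.inr () ↦ t`; each factor has constant term `1`, hence is invertible). -/
noncomputable def shiftedGenFun (n : ℕ) (d : Fin n → ℕ) :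
    MvPowerSeries (Fin n ⊕ Unit) ℤ :=
  ∏ k : Fin n, ∏ j : Fin (d k + 1),
    MvPowerSeries.invOfUnit
      (1 - (MvPowerSeries.X (Sum.inl k)) *
        (MvPowerSeries.X (Sum.inr ())) ^ (2 * (d k - j.1))) 1


/-- Counting series used as an explicit inverse of `∏ (1 - X^(e x))`. -/
noncomputable def countSeries {ι σ : Type*} [Fintype ι] (e : ι → σ →₀ ℕ) (s : Finset ι) :
    MvPowerSeries σ ℤ :=
  fun γ => (({α : ι → ℕ | (∀ x ∉ s, α x = 0) ∧ ∑ x, α x • e x = γ}.ncard : ℕ) : ℤ)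

open Classical in
theorem genfun_aux {ι σ : Type*} [Fintype ι] (e : ι → σ →₀ ℕ)
    (hfin : ∀ γ, {α : ι → ℕ | ∑ x, α x • e x = γ}.Finite) (s : Finset ι) :
    (∏ x ∈ s, (1 - MvPowerSeries.monomial (e x) (1:ℤ))) *
      countSeries e s = 1 := by
  induction s using Finset.induction_on with
  | empty =>
    rw [Finset.prod_empty, one_mul]
    ext γ
    rw [MvPowerSeries.coeff_one]
    change (({α : ι → ℕ | (∀ x ∉ (∅ : Finset ι), α x = 0) ∧ ∑ x, α x • e x = γ}.ncard : ℕ) : ℤ) = _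
    split_ifs with h
    · have : {α : ι → ℕ | (∀ x ∉ (∅ : Finset ι), α x = 0) ∧ ∑ x, α x • e x = γ} = {0} := by
        ext α
        simp only [Set.mem_ofPred_eq, Set.mem_singleton_iff]
        constructor
        · rintro ⟨h1, -⟩
          funext x
          exact h1 x (by simp)
        · rintro rfl
          simp [h]
      rw [this]; simp
    · have : {α : ι → ℕ | (∀ x ∉ (∅ : Finset ι), α x = 0) ∧ ∑ x, α x • e x = γ} = ∅ := by
        ext α
        simp only [Set.mem_ofPred_eq, Set.mem_empty_iff_false, iff_false]
        rintro ⟨h1, h2⟩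
        apply h
        rw [← h2]
        apply Finset.sum_eq_zero
        intro x _
        rw [h1 x (by simp), zero_smul]
      rw [this]; simp
  | insert a s ha ih =>
    rw [Finset.prod_insert ha, mul_comm (1 - _), mul_assoc]
    refine Eq.trans ?_ ih
    congr 1
    ext γ
    rw [sub_mul, one_mul, map_sub, MvPowerSeries.coeff_monomial_mul]
    change (({α : ι → ℕ | (∀ x ∉ insert a s, α x = 0) ∧ ∑ x, α x • e x = γ}.ncard : ℕ) : ℤ)
      - (if e a ≤ γ then 1 * (({α : ι → ℕ | (∀ x ∉ insert a s, α x = 0) ∧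
          ∑ x, α x • e x = γ - e a}.ncard : ℕ) : ℤ) else 0) =
      (({α : ι → ℕ | (∀ x ∉ s, α x = 0) ∧ ∑ x, α x • e x = γ}.ncard : ℕ) : ℤ)
    have hsum : ∀ α : ι → ℕ, ∑ x, (α + Pi.single a 1 : ι → ℕ) x • e x = ∑ x, α x • e x + e a := by
      intro α
      simp only [Pi.add_apply, add_smul, Finset.sum_add_distrib]
      congr 1
      rw [Finset.sum_eq_single a]
      · simp
      · intro b _ hb; simp [Pi.single_eq_of_ne hb]
      · simp
    have hun : {α : ι → ℕ | (∀ x ∉ insert a s, α x = 0) ∧ ∑ x, α x • e x = γ} =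
        {α : ι → ℕ | (∀ x ∉ s, α x = 0) ∧ ∑ x, α x • e x = γ} ∪
        Set.image (fun α => α + Pi.single a 1) {α : ι → ℕ | e a ≤ γ ∧
          (∀ x ∉ insert a s, α x = 0) ∧ ∑ x, α x • e x = γ - e a} := by
      ext α
      simp only [Set.mem_union, Set.mem_ofPred_eq, Set.mem_image]
      constructor
      · rintro ⟨h1, h2⟩
        by_cases h0 : α a = 0
        · left
          refine ⟨fun x hx => ?_, h2⟩
          by_cases hxa : x = a
          · rw [hxa, h0]
          · exact h1 x (by simp [hxa, hx])
        · right
          have hα : (α - Pi.single a 1) + Pi.single a 1 = α := by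
            funext x
            by_cases hxa : x = a
            · subst hxa; simp; omega
            · simp [Pi.single_eq_of_ne hxa]
          have h3 := hsum (α - Pi.single a 1)
          rw [hα, h2] at h3
          refine ⟨α - Pi.single a 1, ⟨?_, ?_, ?_⟩, hα⟩
          · rw [h3]; exact le_add_self
          · intro x hx; simp [h1 x hx]
          · rw [h3, add_tsub_cancel_right]
      · rintro (⟨h1, h2⟩ | ⟨β, ⟨h0, h1, h2⟩, rfl⟩)
        · exact ⟨fun x hx => h1 x (fun h => hx (Finset.mem_insert_of_mem h)), h2⟩
        · refine ⟨fun x hx => ?_, ?_⟩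
          · have : x ≠ a := by rintro rfl; simp at hx
            simp [h1 x hx, Pi.single_eq_of_ne this]
          · rw [hsum, h2, tsub_add_cancel_of_le h0]
    have hf : ∀ (γ : σ →₀ ℕ) (P : (ι → ℕ) → Prop), {α : ι → ℕ | P α ∧ ∑ x, α x • e x = γ}.Finite :=
      fun γ P => (hfin γ).subset (fun α h => h.2)
    rw [hun, Set.ncard_union_eq _ (hf _ _) (Set.Finite.image _ ((hfin (γ - e a)).subset
      (fun α h => h.2.2))), Set.ncard_image_of_injective _ (add_left_injective _)]
    · by_cases h : e a ≤ γ <;> simp [h]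
    · rw [Set.disjoint_left]
      rintro _ ⟨h1, -⟩ ⟨β, -, rfl⟩
      have := h1 a ha
      simp at this

section sl2
variable {M : Type*} [AddCommGroup M] [Module ℂ M] (e f h : M →ₗ[ℂ] M)

theorem sl2_weight (hhe : ∀ u, h (e u) = e (h u) + (2:ℂ) • e u) {u : M} {w : ℂ} (hu : h u = w • u)
    (N : ℕ) : h ((e ^ N) u) = (w + 2 * N) • (e ^ N) u := by
  induction N with
  | zero => simp [hu]
  | succ N ih =>
    rw [pow_succ', Module.End.mul_apply, hhe, ih, map_smul]
    push_cast
    module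

theorem sl2_comm (hef : ∀ u, e (f u) = f (e u) + h u)
    (hhe : ∀ u, h (e u) = e (h u) + (2:ℂ) • e u) {u : M} {w : ℂ} (hu : h u = w • u)
    (N : ℕ) : (e ^ (N + 1)) (f u) = f ((e ^ (N + 1)) u) + (((N:ℂ) + 1) * (w + N)) • (e ^ N) u := by
  induction N with
  | zero => simp [hef, hu]
  | succ N ih =>
    have h1 : (e ^ (N + 1 + 1)) (f u) = e ((e ^ (N + 1)) (f u)) := by
      rw [pow_succ', Module.End.mul_apply]
    have h2 : (e ^ (N + 1 + 1)) u = e ((e ^ (N + 1)) u) := by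
      rw [pow_succ', Module.End.mul_apply]
    have h3 : e ((e ^ N) u) = (e ^ (N + 1)) u := by
      rw [pow_succ', Module.End.mul_apply]
    rw [h1, ih, map_add, hef, map_smul, h3, sl2_weight e h hhe hu, h2]
    push_cast
    module

theorem sl2_surj (hef : ∀ u, e (f u) = f (e u) + h u)
    (hhe : ∀ u, h (e u) = e (h u) + (2:ℂ) • e u)
    (hhf : ∀ u, h (f u) = f (h u) - (2:ℂ) • f u) (Q : Submodule ℂ M)
    (hQe : ∀ u ∈ Q, e u ∈ Q) (hQf : ∀ u ∈ Q, f u ∈ Q) (w : ℕ) (hw : 1 ≤ w) (N : ℕ) :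
    ∀ u ∈ Q, h u = (w:ℂ) • u → (e ^ N) u = 0 →
      ∃ v ∈ Q, h v = ((w:ℂ) - 2) • v ∧ e v = u := by
  induction N with
  | zero =>
    intro u _ _ h0
    exact ⟨0, Q.zero_mem, by simp, by simpa using h0.symm⟩
  | succ N ih =>
    intro u hQ hu h0
    set c : ℂ := ((N:ℂ) + 1) * (w + N) with hc
    have hc0 : c ≠ 0 := by
      have : c = (((N + 1) * (w + N) : ℕ) : ℂ) := by rw [hc]; push_cast; ring
      rw [this, Nat.cast_ne_zero]
      positivity
    have hfu : h (f u) = ((w:ℂ) - 2) • f u := by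
      rw [hhf, hu, map_smul]; module
    have hef' : h (e (f u)) = (w:ℂ) • e (f u) := by
      rw [hhe, hfu, map_smul]; module
    obtain ⟨v, hv, hv1, hv2⟩ := ih (u - c⁻¹ • e (f u))
      (Q.sub_mem hQ (Q.smul_mem _ (hQe _ (hQf _ hQ))))
      (by rw [map_sub, map_smul, hef', hu]; module)
      (by
        have h1 : (e ^ N) (e (f u)) = (e ^ (N + 1)) (f u) := by
          rw [pow_succ, Module.End.mul_apply]
        rw [map_sub, map_smul, h1, sl2_comm e f h hef hhe hu, h0, map_zero, zero_add, smul_smul,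
          inv_mul_cancel₀ hc0, one_smul, sub_self])
    refine ⟨v + c⁻¹ • f u, Q.add_mem hv (Q.smul_mem _ (hQf _ hQ)), ?_, ?_⟩
    · rw [map_add, map_smul, hv1, hfu]; module
    · rw [map_add, map_smul, hv2]; module

end sl2

/-- Diagonal derivations act on coefficients by scalars. -/
theorem coeff_diag {ι : Type*} [Fintype ι] (c : ι → ℂ) (p : MvPolynomial ι ℂ) (α : ι →₀ ℕ) :
    coeff α (mkDerivation ℂ (fun x => c x • (X x : MvPolynomial ι ℂ)) p) =
      (∑ x, c x * α x) * coeff α p := by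
  classical
  induction p using MvPolynomial.induction_on' with
  | add p q hp hq => rw [map_add, coeff_add, coeff_add, hp, hq]; ring
  | monomial s r =>
    have : mkDerivation ℂ (fun x => c x • (X x : MvPolynomial ι ℂ)) (monomial s r) =
        (∑ x, c x * s x) • monomial s r := by
      rw [mkDerivation_monomial, Finsupp.sum, Finset.sum_smul, Finset.smul_sum]
      rw [← Finset.sum_subset (Finset.subset_univ s.support)]
      · refine Finset.sum_congr rfl fun x hx => ?_
        have hx' : Finsupp.single x 1 ≤ s := by
          rw [Finsupp.single_le_iff]
          exact Nat.one_le_iff_ne_zero.mpr (Finsupp.mem_support_iff.mp hx)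
        rw [X, smul_eq_mul, smul_monomial, monomial_mul, tsub_add_cancel_of_le hx', smul_monomial,
          smul_monomial]
        congr 1
        simp only [smul_eq_mul]; ring
      · intro x _ hx
        rw [Finsupp.notMem_support_iff.mp hx]; simp
    rw [this, coeff_smul, coeff_monomial, smul_eq_mul]
    split_ifs with h
    · rw [h]
    · simp

theorem diag_eigen {ι : Type*} [Fintype ι] (c : ι → ℂ) (p : MvPolynomial ι ℂ) (w : ℂ) :
    mkDerivation ℂ (fun x => c x • (X x : MvPolynomial ι ℂ)) p = w • p ↔
      ∀ α ∈ p.support, ∑ x, c x * α x = w := by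
  constructor
  · intro h α hα
    have := congrArg (coeff α) h
    rw [coeff_diag, coeff_smul, smul_eq_mul] at this
    exact mul_right_cancel₀ (mem_support_iff.mp hα) this
  · intro h
    ext α
    rw [coeff_diag, coeff_smul, smul_eq_mul]
    by_cases hα : α ∈ p.support
    · rw [h α hα]
    · rw [notMem_support_iff.mp hα]; simp

/-- The derivation counting the degree in the `k`-th group. -/
noncomputable def Fdeg (n : ℕ) (d : Fin n → ℕ) (k : Fin n) :
    Derivation ℂ (MvPolynomial (Idx n d) ℂ) (MvPolynomial (Idx n d) ℂ) :=
  mkDerivation ℂ (fun x => (if x.1 = k then (1:ℂ) else 0) • X x)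

theorem mem_mdeg_iff (n : ℕ) (d m : Fin n → ℕ) (p : MvPolynomial (Idx n d) ℂ) :
    p ∈ mdeg n d m ↔ ∀ k, Fdeg n d k p = (m k : ℂ) • p := by
  unfold Fdeg
  simp only [diag_eigen]
  change (∀ α ∈ p.support, ∀ k : Fin n, (∑ j : Fin (d k + 1), α ⟨k, j⟩) = m k) ↔ _
  have key : ∀ (α : Idx n d →₀ ℕ) (k : Fin n),
      (∑ x : Idx n d, (if x.1 = k then (1:ℂ) else 0) * α x = m k) ↔
      (∑ j : Fin (d k + 1), α ⟨k, j⟩) = m k := by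
    intro α k
    rw [Fintype.sum_sigma, Finset.sum_eq_single k]
    · simp only [if_true, one_mul]
      exact_mod_cast Iff.rfl
    · intro b _ hb; simp [hb]
    · simp
  constructor
  · intro h k α hα; exact (key α k).mpr (h α hα k)
  · intro h α hα k; exact (key α k).mp (h k α hα)

theorem Fdeg_D1 (n : ℕ) (d : Fin n → ℕ) (k : Fin n) (u : MvPolynomial (Idx n d) ℂ) :
    Fdeg n d k (D1 n d u) = D1 n d (Fdeg n d k u) := by
  have : ⁅Fdeg n d k, D1 n d⁆ = 0 := by
    apply derivation_ext
    rintro ⟨a, j⟩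
    rw [Derivation.commutator_apply]
    simp only [Fdeg, D1, mkDerivation_X, Derivation.map_smul]
    split_ifs <;> simp_all [mkDerivation_X]
  have h := congrArg (fun D => D u) this
  simp only [Derivation.commutator_apply, Derivation.zero_apply] at h
  exact sub_eq_zero.mp h

theorem Fdeg_D2 (n : ℕ) (d : Fin n → ℕ) (k : Fin n) (u : MvPolynomial (Idx n d) ℂ) :
    Fdeg n d k (D2 n d u) = D2 n d (Fdeg n d k u) := by
  have : ⁅Fdeg n d k, D2 n d⁆ = 0 := by
    apply derivation_ext
    rintro ⟨a, j⟩
    rw [Derivation.commutator_apply]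
    simp only [Fdeg, D2, mkDerivation_X, Derivation.map_smul]
    split_ifs <;> simp_all [mkDerivation_X]
  have h := congrArg (fun D => D u) this
  simp only [Derivation.commutator_apply, Derivation.zero_apply] at h
  exact sub_eq_zero.mp h

theorem E_D1 (n : ℕ) (d : Fin n → ℕ) (u : MvPolynomial (Idx n d) ℂ) :
    E n d (D1 n d u) = D1 n d (E n d u) + (2:ℂ) • D1 n d u := by
  have : ⁅E n d, D1 n d⁆ = (2:ℂ) • D1 n d := by
    apply derivation_ext
    rintro ⟨a, j, hj⟩
    rw [Derivation.commutator_apply]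
    simp only [E, D1, mkDerivation_X, Derivation.map_smul, Derivation.smul_apply]
    split_ifs with h
    · simp
    · simp only [Derivation.map_smul, mkDerivation_X]
      obtain ⟨j, rfl⟩ := Nat.exists_eq_succ_of_ne_zero h
      simp only [Nat.succ_eq_add_one, Nat.add_sub_cancel]
      push_cast
      module
  have h := congrArg (fun D => D u) this
  simp only [Derivation.commutator_apply, Derivation.smul_apply] at h
  rw [← h]; abel

theorem E_D2 (n : ℕ) (d : Fin n → ℕ) (u : MvPolynomial (Idx n d) ℂ) :
    E n d (D2 n d u) = D2 n d (E n d u) - (2:ℂ) • D2 n d u := by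
  have : ⁅E n d, D2 n d⁆ = (-2:ℂ) • D2 n d := by
    apply derivation_ext
    rintro ⟨a, j, hj⟩
    rw [Derivation.commutator_apply]
    simp only [E, D2, mkDerivation_X, Derivation.map_smul, Derivation.smul_apply]
    split_ifs with h
    · simp
    · simp only [Derivation.map_smul, mkDerivation_X]
      push_cast
      module
  have h := congrArg (fun D => D u) this
  simp only [Derivation.commutator_apply, Derivation.smul_apply] at h
  have h2 := sub_eq_iff_eq_add.mp h
  rw [h2]; module

theorem D1_D2 (n : ℕ) (d : Fin n → ℕ) (u : MvPolynomial (Idx n d) ℂ) :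
    D1 n d (D2 n d u) = D2 n d (D1 n d u) + E n d u := by
  have : ⁅D1 n d, D2 n d⁆ = E n d := by
    apply derivation_ext
    rintro ⟨a, j, hj⟩
    have h1 : D1 n d (D2 n d (X ⟨a, j, hj⟩)) = (((d a : ℂ) - j) * (j + 1)) • X ⟨a, j, hj⟩ := by
      simp only [D1, D2, mkDerivation_X]
      split_ifs with h
      · rw [map_zero]; simp [h]
      · rw [Derivation.map_smul, mkDerivation_X]
        simp only [Nat.add_eq_zero_iff, one_ne_zero, and_false, dite_false, Nat.add_sub_cancel,
          smul_smul]
        rw [Nat.cast_sub (by omega)]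
        push_cast
        rfl
    have h2 : D2 n d (D1 n d (X ⟨a, j, hj⟩)) = (((d a : ℂ) - j + 1) * j) • X ⟨a, j, hj⟩ := by
      simp only [D1, D2, mkDerivation_X]
      split_ifs with h
      · rw [map_zero]; simp [h]
      · rw [Derivation.map_smul, mkDerivation_X]
        obtain ⟨j, rfl⟩ := Nat.exists_eq_succ_of_ne_zero h
        simp only [Nat.succ_eq_add_one, Nat.add_sub_cancel]
        rw [dif_neg (by omega), smul_smul, Nat.cast_sub (by omega)]
        push_cast
        congr 1
        ring
    rw [Derivation.commutator_apply, h1, h2]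
    simp only [E, mkDerivation_X]
    module
  have h := congrArg (fun D => D u) this
  simp only [Derivation.commutator_apply] at h
  rw [← h]; abel


/-- Exponents of multidegree `m` and weight `w`. -/
def wtSet (n : ℕ) (d m : Fin n → ℕ) (w : ℕ) : Set (Idx n d →₀ ℕ) :=
  {α | (∀ k, ∑ j : Fin (d k + 1), α ⟨k, j⟩ = m k) ∧
    ∑ x : Idx n d, ((d x.1 : ℤ) - 2 * (x.2.1 : ℤ)) * α x = w}

theorem sum_d_mul (n : ℕ) (d m : Fin n → ℕ) (α : Idx n d → ℕ)
    (h : ∀ k, ∑ j : Fin (d k + 1), α ⟨k, j⟩ = m k) :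
    ∑ x : Idx n d, (d x.1) * α x = ∑ k, d k * m k := by
  rw [Fintype.sum_sigma]
  refine Finset.sum_congr rfl fun k _ => ?_
  rw [← h k, Finset.mul_sum]

theorem wtSet_iff (n : ℕ) (d m : Fin n → ℕ) (w : ℕ) (α : Idx n d →₀ ℕ) :
    α ∈ wtSet n d m w ↔ (∀ k, ∑ j : Fin (d k + 1), α ⟨k, j⟩ = m k) ∧
      ∑ x : Idx n d, α x * (2 * x.2.1) + w = ∑ k, d k * m k := by
  unfold wtSet
  rw [Set.mem_ofPred_eq]
  refine and_congr_right fun h => ?_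
  rw [← sum_d_mul n d m α h]
  zify
  have : ∑ x : Idx n d, ((d x.1 : ℤ) - 2 * (x.2.1 : ℤ)) * α x =
      ∑ x : Idx n d, (d x.1 : ℤ) * α x - ∑ x : Idx n d, (α x : ℤ) * (2 * (x.2.1 : ℤ)) := by
    rw [← Finset.sum_sub_distrib]
    exact Finset.sum_congr rfl fun x _ => by ring
  rw [this]
  constructor <;> intro h <;> linarith

theorem wtSet_finite (n : ℕ) (d m : Fin n → ℕ) (w : ℕ) : (wtSet n d m w).Finite := by
  refine Set.Finite.subset (Set.finite_Iic (Finsupp.equivFunOnFinite.symm fun x : Idx n d => m x.1))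
    fun α hα => ?_
  rw [Set.mem_Iic]
  rintro ⟨k, j⟩
  simp only [Finsupp.equivFunOnFinite_symm_apply_apply]
  rw [← hα.1 k]
  exact Finset.single_le_sum (f := fun j => α ⟨k, j⟩) (fun _ _ => Nat.zero_le _) (Finset.mem_univ j)

/-- The weight space. -/
noncomputable def wtSpace (n : ℕ) (d m : Fin n → ℕ) (w : ℕ) :
    Submodule ℂ (MvPolynomial (Idx n d) ℂ) :=
  mdeg n d m ⊓ Module.End.eigenspace ((E n d).toLinearMap) (w : ℂ)

theorem mem_wtSpace (n : ℕ) (d m : Fin n → ℕ) (w : ℕ) (p : MvPolynomial (Idx n d) ℂ) :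
    p ∈ wtSpace n d m w ↔ p ∈ mdeg n d m ∧ E n d p = (w : ℂ) • p := by
  unfold wtSpace
  rw [Submodule.mem_inf, Module.End.mem_eigenspace_iff]
  rfl

theorem wtSpace_eq (n : ℕ) (d m : Fin n → ℕ) (w : ℕ) :
    wtSpace n d m w = restrictSupport ℂ (wtSet n d m w) := by
  ext p
  rw [mem_wtSpace, mem_restrictSupport_iff]
  unfold E
  rw [diag_eigen]
  have key : ∀ α : Idx n d →₀ ℕ,
      (∑ x : Idx n d, ((d x.1 : ℂ) - 2 * (x.2.1 : ℂ)) * α x = w) ↔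
      (∑ x : Idx n d, ((d x.1 : ℤ) - 2 * (x.2.1 : ℤ)) * α x = w) := by
    intro α
    exact_mod_cast Iff.rfl
  constructor
  · rintro ⟨h1, h2⟩ α hα
    exact ⟨h1 α hα, (key α).mp (h2 α hα)⟩
  · intro h
    exact ⟨fun α hα => (h hα).1, fun α hα => (key α).mpr (h hα).2⟩

theorem finrank_wtSpace (n : ℕ) (d m : Fin n → ℕ) (w : ℕ) :
    Module.finrank ℂ (wtSpace n d m w) = (wtSet n d m w).ncard := by
  rw [wtSpace_eq, Module.finrank_eq_nat_card_basis (basisRestrictSupport ℂ (wtSet n d m w))]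
  exact Nat.card_coe_set_eq _

theorem finite_wtSpace (n : ℕ) (d m : Fin n → ℕ) (w : ℕ) :
    FiniteDimensional ℂ (wtSpace n d m w) := by
  rw [wtSpace_eq]
  have := (wtSet_finite n d m w).to_subtype
  exact Module.Finite.of_basis (basisRestrictSupport ℂ (wtSet n d m w))

theorem wtSet_empty (n : ℕ) (d m : Fin n → ℕ) (w : ℕ) (hw : ∑ k, d k * m k < w) :
    wtSet n d m w = ∅ := by
  ext α
  simp only [Set.mem_empty_iff_false, iff_false, wtSet_iff]
  rintro ⟨-, h⟩
  omega

theorem D1_mem_mdeg (n : ℕ) (d m : Fin n → ℕ) (u : MvPolynomial (Idx n d) ℂ)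
    (hu : u ∈ mdeg n d m) : D1 n d u ∈ mdeg n d m := by
  rw [mem_mdeg_iff] at hu ⊢
  intro k
  rw [Fdeg_D1, hu k, Derivation.map_smul]

theorem D2_mem_mdeg (n : ℕ) (d m : Fin n → ℕ) (u : MvPolynomial (Idx n d) ℂ)
    (hu : u ∈ mdeg n d m) : D2 n d u ∈ mdeg n d m := by
  rw [mem_mdeg_iff] at hu ⊢
  intro k
  rw [Fdeg_D2, hu k, Derivation.map_smul]

theorem D1_mem_wtSpace (n : ℕ) (d m : Fin n → ℕ) (w : ℕ) (u : MvPolynomial (Idx n d) ℂ)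
    (hu : u ∈ wtSpace n d m w) : D1 n d u ∈ wtSpace n d m (w + 2) := by
  rw [mem_wtSpace] at hu ⊢
  refine ⟨D1_mem_mdeg n d m u hu.1, ?_⟩
  rw [E_D1, hu.2, Derivation.map_smul]
  push_cast
  module

theorem D1_nilp (n : ℕ) (d m : Fin n → ℕ) (w : ℕ) (u : MvPolynomial (Idx n d) ℂ)
    (hu : u ∈ wtSpace n d m w) : ((D1 n d).toLinearMap ^ (∑ k, d k * m k + 1)) u = 0 := by
  have h : ∀ N, ((D1 n d).toLinearMap ^ N) u ∈ wtSpace n d m (w + 2 * N) := by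
    intro N
    induction N with
    | zero => simpa using hu
    | succ N ih =>
      rw [pow_succ', Module.End.mul_apply]
      exact D1_mem_wtSpace n d m _ _ ih
  have h1 := h (∑ k, d k * m k + 1)
  rw [wtSpace_eq, wtSet_empty n d m _ (by omega), mem_restrictSupport_iff] at h1
  rw [← support_eq_empty]
  exact_mod_cast Set.subset_empty_iff.mp h1

theorem D1_surj (n : ℕ) (d m : Fin n → ℕ) (w : ℕ) (u : MvPolynomial (Idx n d) ℂ)
    (hu : u ∈ wtSpace n d m (w + 2)) : ∃ v ∈ wtSpace n d m w, D1 n d v = u := by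
  have hu' := (mem_wtSpace n d m _ u).mp hu
  obtain ⟨v, hv, hv1, hv2⟩ := sl2_surj (D1 n d).toLinearMap (D2 n d).toLinearMap
    (E n d).toLinearMap (D1_D2 n d) (E_D1 n d) (E_D2 n d) (mdeg n d m)
    (D1_mem_mdeg n d m) (D2_mem_mdeg n d m) (w + 2) (by omega) _ u hu'.1 hu'.2
    (D1_nilp n d m _ u hu)
  refine ⟨v, (mem_wtSpace n d m _ v).mpr ⟨hv, ?_⟩, hv2⟩
  have hv3 : E n d v = (((w + 2 : ℕ) : ℂ) - 2) • v := hv1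
  rw [hv3]
  push_cast
  module

theorem finrank_target (n : ℕ) (d m : Fin n → ℕ) (i : ℕ) :
    Module.finrank ℂ ↥(mdeg n d m ⊓ LinearMap.ker (D1 n d).toLinearMap ⊓
        Module.End.eigenspace ((E n d).toLinearMap) (i : ℂ)) + (wtSet n d m (i + 2)).ncard =
      (wtSet n d m i).ncard := by
  rw [← finrank_wtSpace, ← finrank_wtSpace]
  have := finite_wtSpace n d m i
  set T := mdeg n d m ⊓ LinearMap.ker (D1 n d).toLinearMap ⊓
        Module.End.eigenspace ((E n d).toLinearMap) (i : ℂ) with hT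
  have hle : T ≤ wtSpace n d m i := fun x hx => ⟨hx.1.1, hx.2⟩
  let φ := (D1 n d).toLinearMap.restrict (p := wtSpace n d m i) (q := wtSpace n d m (i + 2))
    (D1_mem_wtSpace n d m i)
  have hker : LinearMap.ker φ = T.comap (wtSpace n d m i).subtype := by
    ext ⟨x, hx⟩
    rw [LinearMap.mem_ker, Submodule.mem_comap, Subtype.ext_iff]
    change D1 n d x = 0 ↔ x ∈ T
    constructor
    · intro h; exact ⟨⟨hx.1, h⟩, hx.2⟩
    · intro h; exact h.1.2
  have hrange : LinearMap.range φ = ⊤ := by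
    rw [LinearMap.range_eq_top]
    rintro ⟨u, hu⟩
    obtain ⟨v, hv, hvu⟩ := D1_surj n d m i u hu
    exact ⟨⟨v, hv⟩, Subtype.ext hvu⟩
  have h := φ.finrank_range_add_finrank_ker
  rw [hrange, hker, finrank_top, (Submodule.comapSubtypeEquivOfLe hle).finrank_eq] at h
  omega

/-- Exponent of the factor attached to a variable (after reversing the order of the `j`). -/
noncomputable def expo (n : ℕ) (d : Fin n → ℕ) (x : Idx n d) : (Fin n ⊕ Unit) →₀ ℕ :=
  Finsupp.single (Sum.inl x.1) 1 + Finsupp.single (Sum.inr ()) (2 * x.2.1)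

theorem sum_expo_inl (n : ℕ) (d : Fin n → ℕ) (α : Idx n d → ℕ) (k : Fin n) :
    (∑ x, α x • expo n d x) (Sum.inl k) = ∑ j : Fin (d k + 1), α ⟨k, j⟩ := by
  rw [Finsupp.finsetSum_apply, Fintype.sum_sigma, Finset.sum_eq_single k]
  · simp [expo]
  · intro b _ hb; simp [expo, hb]
  · simp

theorem sum_expo_inr (n : ℕ) (d : Fin n → ℕ) (α : Idx n d → ℕ) :
    (∑ x, α x • expo n d x) (Sum.inr ()) = ∑ x : Idx n d, α x * (2 * x.2.1) := by
  rw [Finsupp.finsetSum_apply]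
  simp [expo]

theorem expo_fin (n : ℕ) (d : Fin n → ℕ) (γ : (Fin n ⊕ Unit) →₀ ℕ) :
    {α : Idx n d → ℕ | ∑ x, α x • expo n d x = γ}.Finite := by
  refine Set.Finite.subset (Set.finite_Iic (fun x : Idx n d => γ (Sum.inl x.1))) fun α hα => ?_
  rw [Set.mem_Iic]
  rintro ⟨k, j⟩
  have h : ∑ x, α x • expo n d x = γ := hα
  simp only
  rw [← h, sum_expo_inl]
  exact Finset.single_le_sum (f := fun j => α ⟨k, j⟩) (fun _ _ => Nat.zero_le _) (Finset.mem_univ j)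

theorem shiftedGenFun_eq (n : ℕ) (d : Fin n → ℕ) :
    shiftedGenFun n d = countSeries (expo n d) Finset.univ := by
  have h1 := genfun_aux (expo n d) (expo_fin n d) Finset.univ
  have h2 : (∏ x : Idx n d, (1 - MvPowerSeries.monomial (expo n d x) (1:ℤ))) *
      shiftedGenFun n d = 1 := by
    rw [Fintype.prod_sigma, shiftedGenFun, ← Finset.prod_mul_distrib]
    refine Finset.prod_eq_one fun k _ => ?_
    rw [← Equiv.prod_comp Fin.revPerm, ← Finset.prod_mul_distrib]
    refine Finset.prod_eq_one fun j _ => ?_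
    have : MvPowerSeries.monomial (expo n d ⟨k, Fin.revPerm j⟩) (1:ℤ) =
        (MvPowerSeries.X (Sum.inl k)) * (MvPowerSeries.X (Sum.inr ())) ^ (2 * (d k - j.1)) := by
      rw [MvPowerSeries.X_pow_eq, MvPowerSeries.X_def, MvPowerSeries.monomial_mul_monomial, one_mul]
      congr 2
      simp [expo, Fin.val_rev]
    rw [this]
    apply MvPowerSeries.mul_invOfUnit
    simp
  calc shiftedGenFun n d = shiftedGenFun n d * 1 := (mul_one _).symm
    _ = _ := by rw [← h1, ← mul_assoc, mul_comm (shiftedGenFun n d), h2, one_mul]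

theorem coeff_shifted (n : ℕ) (d m : Fin n → ℕ) (i : ℕ) (hi : i ≤ ∑ k : Fin n, d k * m k) :
    MvPowerSeries.coeff (Finsupp.equivFunOnFinite.symm
          (Sum.elim m fun _ => (∑ k : Fin n, d k * m k) - i)) (shiftedGenFun n d) =
      ((wtSet n d m i).ncard : ℤ) := by
  rw [shiftedGenFun_eq]
  change (({α : Idx n d → ℕ | (∀ x ∉ Finset.univ, α x = 0) ∧ ∑ x, α x • expo n d x =
    Finsupp.equivFunOnFinite.symm (Sum.elim m fun _ => (∑ k : Fin n, d k * m k) - i)}.ncard : ℕ) : ℤ)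
    = _
  congr 1
  rw [← Set.ncard_image_of_injective (wtSet n d m i)
    (Finsupp.equivFunOnFinite (α := Idx n d) (M := ℕ)).injective]
  congr 1
  ext α
  rw [Equiv.image_eq_preimage_symm, Set.mem_preimage, wtSet_iff, Set.mem_ofPred_eq]
  simp only [Finset.mem_univ, not_true_eq_false, false_imp_iff, implies_true, true_and,
    Finsupp.equivFunOnFinite_symm_apply_apply]
  constructor
  · intro h
    constructor
    · intro k
      rw [← sum_expo_inl, h]
      simp
    · rw [← sum_expo_inr, h]
      simp only [Finsupp.equivFunOnFinite_symm_apply_apply, Sum.elim_inr]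
      omega
  · rintro ⟨h1, h2⟩
    ext (k | ⟨⟩)
    · rw [sum_expo_inl, h1]; simp
    · rw [sum_expo_inr]
      simp only [Finsupp.equivFunOnFinite_symm_apply_apply, Sum.elim_inr]
      omega

/-- For `0 ≤ i ≤ ∑ d_k m_k`, the dimension of the space of multidegree-`m` polynomials
with `D1 f = 0` and `E f = i • f` equals the coefficient of
`z_1^{m_1} ⋯ z_n^{m_n} t^{(∑ d_k m_k) - i}` in
`(1 - t²) ∏_k ∏_j (1 - z_k t^{2(d_k - j)})⁻¹`. -/
theorem dim_semiinvariants_eq_coeff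
    (n : ℕ) (hn : 1 ≤ n) (d : Fin n → ℕ) (hd : ∀ k, 1 ≤ d k)
    (m : Fin n → ℕ) (i : ℕ) (hi : i ≤ ∑ k : Fin n, d k * m k) :
    (Module.finrank ℂ ↥(mdeg n d m ⊓ LinearMap.ker (D1 n d).toLinearMap ⊓
        Module.End.eigenspace ((E n d).toLinearMap) (i : ℂ)) : ℤ) =
      MvPowerSeries.coeff
        (Finsupp.equivFunOnFinite.symm
          (Sum.elim m fun _ => (∑ k : Fin n, d k * m k) - i))
        ((1 - (MvPowerSeries.X (Sum.inr () : Fin n ⊕ Unit)) ^ 2) *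
          shiftedGenFun n d) := by
  have hfr := finrank_target n d m i
  rw [sub_mul, one_mul, map_sub, coeff_shifted n d m i hi, MvPowerSeries.X_pow_eq,
    MvPowerSeries.coeff_monomial_mul]
  simp only [Finsupp.single_le_iff, Finsupp.equivFunOnFinite_symm_apply_apply, Sum.elim_inr, one_mul]
  split_ifs with h
  · have : (Finsupp.equivFunOnFinite.symm
          (Sum.elim m fun _ => (∑ k : Fin n, d k * m k) - i)) - Finsupp.single (Sum.inr ()) 2 =
        (Finsupp.equivFunOnFinite.symm
          (Sum.elim m fun _ => (∑ k : Fin n, d k * m k) - (i + 2)) : (Fin n ⊕ Unit) →₀ ℕ) := by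
      ext (k | ⟨⟩)
      · simp
      · simp [Nat.sub_sub]
    rw [this, coeff_shifted n d m (i + 2) (by omega)]
    omega
  · rw [wtSet_empty n d m (i + 2) (by omega), Set.ncard_empty] at hfr
    omega
end

section
/- Let n = 2 and d = (1,1). For all m_1, m_2, j ∈ ℕ, the dimension of the ℂ-vector space of polynomials f ∈ R of multidegree (m_1,m_2) with D1(f) = 0 and E(f) = j·f equals the coefficient of z_1^{m_1} z_2^{m_2} t^{j} in the formal power series ((1 − z_1 t)(1 − z_2 t)(1 − z_1 z_2))^{−1} ∈ ℤ[[z_1,z_2,t]]; i.e., the multivariate Poincaré series of the algebra of joint covariants of two binary linear forms is 1/((1 − z_1 t)(1 − z_2 t)(1 − z_1 z_2)). -/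
open MvPolynomial

/-! ### The power series side -/

/-- Indicator power series of a predicate on the three exponents. -/
noncomputable def indPS (P : ℕ → ℕ → ℕ → Prop) : MvPowerSeries (Fin 2 ⊕ Unit) ℤ :=
  open Classical in
  fun n => if P (n (Sum.inl 0)) (n (Sum.inl 1)) (n (Sum.inr ())) then 1 else 0

open Classical in
lemma coeff_indPS (P : ℕ → ℕ → ℕ → Prop) (n : Fin 2 ⊕ Unit →₀ ℕ) :
    MvPowerSeries.coeff n (indPS P) =
      if P (n (Sum.inl 0)) (n (Sum.inl 1)) (n (Sum.inr ())) then 1 else 0 := rfl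

open Classical in
lemma coeff_one_sub_mul_indPS (a b : Fin 2 ⊕ Unit) (P : ℕ → ℕ → ℕ → Prop)
    (n : Fin 2 ⊕ Unit →₀ ℕ) (hab : a ≠ b) :
    MvPowerSeries.coeff n ((1 - MvPowerSeries.X a * MvPowerSeries.X b) * indPS P) =
      (if P (n (Sum.inl 0)) (n (Sum.inl 1)) (n (Sum.inr ())) then 1 else 0) -
      (if 1 ≤ n a ∧ 1 ≤ n b then
        MvPowerSeries.coeff (n - (Finsupp.single a 1 + Finsupp.single b 1)) (indPS P) else 0) := by
  rw [sub_mul, one_mul, map_sub, coeff_indPS]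
  congr 1
  rw [MvPowerSeries.X, MvPowerSeries.X, MvPowerSeries.monomial_mul_monomial,
    MvPowerSeries.coeff_monomial_mul, one_mul, one_mul]
  have : (Finsupp.single a 1 + Finsupp.single b 1 ≤ n) ↔ (1 ≤ n a ∧ 1 ≤ n b) := by
    constructor
    · intro h
      have h1 := h a
      have h2 := h b
      simp [Finsupp.single_apply, hab, hab.symm] at h1 h2
      omega
    · rintro ⟨h1, h2⟩ c
      simp only [Finsupp.add_apply, Finsupp.single_apply]
      by_cases hac : a = c
      · subst hac; simp [hab.symm, h1]
      · by_cases hbc : b = c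
        · subst hbc; simp [hab, h2]
        · simp [hac, hbc]
  simp only [this]

lemma step1 : (1 - MvPowerSeries.X (Sum.inl 0 : Fin 2 ⊕ Unit) * MvPowerSeries.X (Sum.inl 1)) *
    indPS (fun x y t => t ≤ x + y ∧ x ≤ y + t ∧ y ≤ x + t ∧ (x + y + t) % 2 = 0) =
    indPS (fun x y t => x + y = t) := by
  ext n
  rw [coeff_one_sub_mul_indPS _ _ _ _ (by simp), coeff_indPS, coeff_indPS]
  simp [Finsupp.single_apply]
  split_ifs <;> first | rfl | (exfalso; omega)

lemma step2 : (1 - MvPowerSeries.X (Sum.inl 1 : Fin 2 ⊕ Unit) * MvPowerSeries.X (Sum.inr ())) *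
    indPS (fun x y t => x + y = t) =
    indPS (fun x y t => y = 0 ∧ x = t) := by
  ext n
  rw [coeff_one_sub_mul_indPS _ _ _ _ (by simp), coeff_indPS, coeff_indPS]
  simp [Finsupp.single_apply]
  split_ifs <;> first | rfl | (exfalso; omega)

lemma step3 : (1 - MvPowerSeries.X (Sum.inl 0 : Fin 2 ⊕ Unit) * MvPowerSeries.X (Sum.inr ())) *
    indPS (fun x y t => y = 0 ∧ x = t) = 1 := by
  classical
  ext n
  rw [coeff_one_sub_mul_indPS _ _ _ _ (by simp), coeff_indPS, MvPowerSeries.coeff_one]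
  have h0 : n = 0 ↔ (n (Sum.inl 0) = 0 ∧ n (Sum.inl 1) = 0 ∧ n (Sum.inr ()) = 0) := by
    constructor
    · rintro rfl; simp
    · rintro ⟨h1, h2, h3⟩
      ext c
      rcases c with c | c
      · fin_cases c
        · exact h1
        · exact h2
      · exact h3
  simp only [h0]
  simp [Finsupp.single_apply]
  split_ifs <;> first | rfl | (exfalso; omega)

lemma inv_eq_indPS :
    (MvPowerSeries.invOfUnit
          ((1 - MvPowerSeries.X (Sum.inl 0 : Fin 2 ⊕ Unit) *
              MvPowerSeries.X (Sum.inr ())) *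
           (1 - MvPowerSeries.X (Sum.inl 1 : Fin 2 ⊕ Unit) *
              MvPowerSeries.X (Sum.inr ())) *
           (1 - MvPowerSeries.X (Sum.inl 0 : Fin 2 ⊕ Unit) *
              MvPowerSeries.X (Sum.inl 1))) 1 : MvPowerSeries (Fin 2 ⊕ Unit) ℤ) =
    indPS (fun x y t => t ≤ x + y ∧ x ≤ y + t ∧ y ≤ x + t ∧ (x + y + t) % 2 = 0) := by
  refine left_inv_eq_right_inv (MvPowerSeries.invOfUnit_mul _ _ (by simp)) ?_
  rw [mul_assoc, step1, mul_assoc, step2, step3]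

/-! ### The polynomial side -/

/-- The index type. -/
abbrev II := Idx 2 ![1, 1]
/-- first variable -/
def x0 : II := ⟨0, (0 : Fin 2)⟩
/-- second variable -/
def x1 : II := ⟨0, (1 : Fin 2)⟩
/-- third variable -/
def y0 : II := ⟨1, (0 : Fin 2)⟩
/-- fourth variable -/
def y1 : II := ⟨1, (1 : Fin 2)⟩

lemma II_cases (i : II) : i = x0 ∨ i = x1 ∨ i = y0 ∨ i = y1 := by
  revert i; decide

lemma ne01 : x0 ≠ x1 := by decide
lemma ne02 : x0 ≠ y0 := by decide
lemma ne03 : x0 ≠ y1 := by decide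
lemma ne12 : x1 ≠ y0 := by decide
lemma ne13 : x1 ≠ y1 := by decide
lemma ne23 : y0 ≠ y1 := by decide

lemma D1_x0 : D1 2 ![1, 1] (X x0) = 0 :=
  (mkDerivation_X _ _ _).trans (dif_pos rfl)
lemma D1_y0 : D1 2 ![1, 1] (X y0) = 0 :=
  (mkDerivation_X _ _ _).trans (dif_pos rfl)
lemma D1_x1 : D1 2 ![1, 1] (X x1) = X x0 := by
  refine (mkDerivation_X _ _ _).trans ((dif_neg Nat.one_ne_zero).trans ?_)
  change ((1 : ℕ) : ℂ) • (X x0 : MvPolynomial II ℂ) = X x0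
  rw [Nat.cast_one, one_smul]
lemma D1_y1 : D1 2 ![1, 1] (X y1) = X y0 := by
  refine (mkDerivation_X _ _ _).trans ((dif_neg Nat.one_ne_zero).trans ?_)
  change ((1 : ℕ) : ℂ) • (X y0 : MvPolynomial II ℂ) = X y0
  rw [Nat.cast_one, one_smul]

lemma E_x0 : E 2 ![1, 1] (X x0) = X x0 := by simp [E, x0, mkDerivation_X]
lemma E_y0 : E 2 ![1, 1] (X y0) = X y0 := by simp [E, y0, mkDerivation_X]
lemma E_x1 : E 2 ![1, 1] (X x1) = - X x1 := by
  simp [E, x1, mkDerivation_X]; norm_num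
lemma E_y1 : E 2 ![1, 1] (X y1) = - X y1 := by
  simp [E, y1, mkDerivation_X]; norm_num

lemma D1_eq : D1 2 ![1, 1] = (X x0 : MvPolynomial II ℂ) • pderiv x1 + (X y0 : MvPolynomial II ℂ) • pderiv y1 := by
  apply derivation_ext
  intro i
  rcases II_cases i with rfl | rfl | rfl | rfl
  · simp [D1_x0, pderiv_X_of_ne ne01, pderiv_X_of_ne ne03]
  · simp [D1_x1, pderiv_X_of_ne ne13]
  · simp [D1_y0, pderiv_X_of_ne ne12.symm, pderiv_X_of_ne ne23]
  · simp [D1_y1, pderiv_X_of_ne ne13.symm]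

lemma E_eq : E 2 ![1, 1] = (X x0 : MvPolynomial II ℂ) • pderiv x0 - (X x1 : MvPolynomial II ℂ) • pderiv x1
    + (X y0 : MvPolynomial II ℂ) • pderiv y0 - (X y1 : MvPolynomial II ℂ) • pderiv y1 := by
  apply derivation_ext
  intro i
  rcases II_cases i with rfl | rfl | rfl | rfl
  · simp [E_x0, pderiv_X_of_ne ne01, pderiv_X_of_ne ne02, pderiv_X_of_ne ne03]
  · simp [E_x1, pderiv_X_of_ne ne01.symm, pderiv_X_of_ne ne12, pderiv_X_of_ne ne13]
  · simp [E_y0, pderiv_X_of_ne ne02.symm, pderiv_X_of_ne ne12.symm, pderiv_X_of_ne ne23]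
  · simp [E_y1, pderiv_X_of_ne ne03.symm, pderiv_X_of_ne ne13.symm, pderiv_X_of_ne ne23.symm]

lemma coeff_X_pderiv_self (i : II) (f : MvPolynomial II ℂ) (α : II →₀ ℕ) :
    coeff α (X i * pderiv i f) = α i * coeff α f := by
  classical
  rw [coeff_X_mul']
  split_ifs with h
  · have h1 : Finsupp.single i 1 ≤ α := by
      rw [Finsupp.single_le_iff]
      have := Finsupp.mem_support_iff.mp h
      omega
    rw [coeff_pderiv, tsub_add_cancel_of_le h1]
    have h2 := h1 i
    simp at h2
    simp [Nat.cast_sub h2]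
    ring
  · simp [Finsupp.notMem_support_iff.mp h]

lemma coeff_E (f : MvPolynomial II ℂ) (α : II →₀ ℕ) :
    coeff α (E 2 ![1, 1] f) = ((α x0 : ℂ) - α x1 + α y0 - α y1) * coeff α f := by
  rw [E_eq]
  simp only [Derivation.add_apply, Derivation.sub_apply, Derivation.smul_apply, smul_eq_mul,
    coeff_add, coeff_sub, coeff_X_pderiv_self]
  ring

/-- Exponent vector. -/
noncomputable def ee (p q r s : ℕ) : II →₀ ℕ :=
  Finsupp.single x0 p + Finsupp.single x1 q + Finsupp.single y0 r + Finsupp.single y1 s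

lemma ee_x0 (p q r s : ℕ) : ee p q r s x0 = p := by
  simp [ee, Finsupp.single_apply, ne01.symm, ne02.symm, ne03.symm]
lemma ee_x1 (p q r s : ℕ) : ee p q r s x1 = q := by
  simp [ee, Finsupp.single_apply, ne01, ne12.symm, ne13.symm]
lemma ee_y0 (p q r s : ℕ) : ee p q r s y0 = r := by
  simp [ee, Finsupp.single_apply, ne02, ne12, ne23.symm]
lemma ee_y1 (p q r s : ℕ) : ee p q r s y1 = s := by
  simp [ee, Finsupp.single_apply, ne03, ne13, ne23]

lemma eq_ee (α : II →₀ ℕ) : α = ee (α x0) (α x1) (α y0) (α y1) := by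
  ext i
  rcases II_cases i with rfl | rfl | rfl | rfl
  · rw [ee_x0]
  · rw [ee_x1]
  · rw [ee_y0]
  · rw [ee_y1]

lemma ee_ext {α : II →₀ ℕ} {p q r s : ℕ} (h0 : α x0 = p) (h1 : α x1 = q) (h2 : α y0 = r)
    (h3 : α y1 = s) : α = ee p q r s := by
  subst h0 h1 h2 h3; exact eq_ee α

lemma coeff_X_mul_ee_x0_zero (g : MvPolynomial II ℂ) (q r s : ℕ) :
    coeff (ee 0 q r s) (X x0 * g) = 0 := by
  classical
  rw [coeff_X_mul', if_neg]; simp [ee_x0]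

lemma coeff_X_mul_ee_y0_zero (g : MvPolynomial II ℂ) (p q s : ℕ) :
    coeff (ee p q 0 s) (X y0 * g) = 0 := by
  classical
  rw [coeff_X_mul', if_neg]; simp [ee_y0]

lemma coeff_X_mul_ee_x0 (g : MvPolynomial II ℂ) (p q r s : ℕ) :
    coeff (ee (p + 1) q r s) (X x0 * g) = coeff (ee p q r s) g := by
  have : ee (p + 1) q r s = Finsupp.single x0 1 + ee p q r s := by
    simp only [ee, Finsupp.single_add]; abel
  rw [this, coeff_X_mul]

lemma coeff_X_mul_ee_y0 (g : MvPolynomial II ℂ) (p q r s : ℕ) :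
    coeff (ee p q (r + 1) s) (X y0 * g) = coeff (ee p q r s) g := by
  have : ee p q (r + 1) s = Finsupp.single y0 1 + ee p q r s := by
    simp only [ee, Finsupp.single_add]; abel
  rw [this, coeff_X_mul]

lemma coeff_pderiv_x1 (f : MvPolynomial II ℂ) (p q r s : ℕ) :
    coeff (ee p q r s) (pderiv x1 f) = coeff (ee p (q + 1) r s) f * (q + 1) := by
  have : ee p (q + 1) r s = ee p q r s + Finsupp.single x1 1 := by
    simp only [ee, Finsupp.single_add]; abel
  rw [this, coeff_pderiv, ee_x1]

lemma coeff_pderiv_y1 (f : MvPolynomial II ℂ) (p q r s : ℕ) :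
    coeff (ee p q r s) (pderiv y1 f) = coeff (ee p q r (s + 1)) f * (s + 1) := by
  have : ee p q r (s + 1) = ee p q r s + Finsupp.single y1 1 := by
    simp only [ee, Finsupp.single_add]; abel
  rw [this, coeff_pderiv, ee_y1]

lemma D1_apply (f : MvPolynomial II ℂ) :
    D1 2 ![1, 1] f = X x0 * pderiv x1 f + X y0 * pderiv y1 f := by
  rw [D1_eq]; rfl

lemma cast_ne (q : ℕ) : ((q : ℂ) + 1) ≠ 0 := by exact_mod_cast Nat.succ_ne_zero q

section ker
variable {f : MvPolynomial II ℂ} (hf : D1 2 ![1, 1] f = 0)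

lemma rel_mid (f : MvPolynomial II ℂ) (hf : D1 2 ![1, 1] f = 0) (p q r s : ℕ) :
    coeff (ee p (q + 1) (r + 1) s) f * (q + 1) + coeff (ee (p + 1) q r (s + 1)) f * (s + 1) = 0 := by
  have := congrArg (coeff (ee (p + 1) q (r + 1) s)) hf
  rwa [D1_apply, coeff_add, coeff_X_mul_ee_x0, coeff_X_mul_ee_y0, coeff_pderiv_x1,
    coeff_pderiv_y1, coeff_zero] at this

lemma rel_p0 (f : MvPolynomial II ℂ) (hf : D1 2 ![1, 1] f = 0) (q r s : ℕ) :
    coeff (ee 0 q r (s + 1)) f = 0 := by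
  have := congrArg (coeff (ee 0 q (r + 1) s)) hf
  rw [D1_apply, coeff_add, coeff_X_mul_ee_x0_zero, coeff_X_mul_ee_y0,
    coeff_pderiv_y1, coeff_zero, zero_add] at this
  exact (mul_eq_zero.mp this).resolve_right (cast_ne s)

lemma rel_r0 (f : MvPolynomial II ℂ) (hf : D1 2 ![1, 1] f = 0) (p q s : ℕ) :
    coeff (ee p (q + 1) 0 s) f = 0 := by
  have := congrArg (coeff (ee (p + 1) q 0 s)) hf
  rw [D1_apply, coeff_add, coeff_X_mul_ee_y0_zero, coeff_X_mul_ee_x0,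
    coeff_pderiv_x1, coeff_zero, add_zero] at this
  exact (mul_eq_zero.mp this).resolve_right (cast_ne q)

lemma zero_of_base (f : MvPolynomial II ℂ) (hf : D1 2 ![1, 1] f = 0)
    (h : ∀ p r s, coeff (ee p 0 r s) f = 0) : f = 0 := by
  have key : ∀ q p r s, coeff (ee p q r s) f = 0 := by
    intro q
    induction q with
    | zero => exact h
    | succ q ih =>
      intro p r s
      cases r with
      | zero => exact rel_r0 f hf p q s
      | succ r =>
        have := rel_mid f hf p q r s
        rw [ih, zero_mul, add_zero] at this
        exact (mul_eq_zero.mp this).resolve_right (cast_ne q)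
  rw [MvPolynomial.eq_zero_iff]
  intro α
  rw [eq_ee α]
  exact key _ _ _ _

lemma zero_of_lt (f : MvPolynomial II ℂ) (hf : D1 2 ![1, 1] f = 0) :
    ∀ p q r s, p < s → coeff (ee p q r s) f = 0 := by
  intro p
  induction p with
  | zero =>
    intro q r s hs
    obtain ⟨s, rfl⟩ : ∃ s', s = s' + 1 := ⟨s - 1, by omega⟩
    exact rel_p0 f hf q r s
  | succ p ih =>
    intro q r s hs
    obtain ⟨s, rfl⟩ : ∃ s', s = s' + 1 := ⟨s - 1, by omega⟩
    have := rel_mid f hf p q r s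
    rw [ih _ _ _ (by omega), zero_mul, zero_add] at this
    exact (mul_eq_zero.mp this).resolve_right (cast_ne s)

end ker

/-- The space of covariants of given multidegree and order. -/
noncomputable abbrev covS (m₁ m₂ j : ℕ) : Submodule ℂ (MvPolynomial II ℂ) :=
  mdeg 2 ![1, 1] ![m₁, m₂] ⊓ LinearMap.ker (D1 2 ![1, 1]).toLinearMap ⊓
        Module.End.eigenspace ((E 2 ![1, 1]).toLinearMap) (j : ℂ)

lemma mem_mdeg (m₁ m₂ : ℕ) (f : MvPolynomial II ℂ) :
    f ∈ mdeg 2 ![1, 1] ![m₁, m₂] ↔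
      ∀ α, coeff α f ≠ 0 → α x0 + α x1 = m₁ ∧ α y0 + α y1 = m₂ := by
  change (∀ α ∈ f.support, ∀ k : Fin 2, _) ↔ _
  simp only [Fin.forall_fin_two, mem_support_iff]
  have h0 : ∀ α : II →₀ ℕ, ∑ j : Fin ((![1, 1] : Fin 2 → ℕ) 0 + 1), α ⟨0, j⟩ = α x0 + α x1 :=
    fun α => Fin.sum_univ_two (fun j : Fin 2 => α ⟨0, j⟩)
  have h1 : ∀ α : II →₀ ℕ, ∑ j : Fin ((![1, 1] : Fin 2 → ℕ) 1 + 1), α ⟨1, j⟩ = α y0 + α y1 :=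
    fun α => Fin.sum_univ_two (fun j : Fin 2 => α ⟨1, j⟩)
  simp only [h0, h1]
  rfl

lemma mem_covS (m₁ m₂ j : ℕ) (f : MvPolynomial II ℂ) :
    f ∈ covS m₁ m₂ j ↔ f ∈ mdeg 2 ![1, 1] ![m₁, m₂] ∧ D1 2 ![1, 1] f = 0 ∧
      E 2 ![1, 1] f = (j : ℂ) • f := by
  simp [covS, Submodule.mem_inf, Module.End.mem_eigenspace_iff, and_assoc]

lemma supp_covS {m₁ m₂ j : ℕ} {f : MvPolynomial II ℂ} (hf : f ∈ covS m₁ m₂ j) (p q r s : ℕ)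
    (h : coeff (ee p q r s) f ≠ 0) : p + q = m₁ ∧ r + s = m₂ ∧ p + r = q + s + j := by
  rw [mem_covS] at hf
  obtain ⟨h1, h2, h3⟩ := hf
  have h4 := (mem_mdeg _ _ _).mp h1 _ h
  rw [ee_x0, ee_x1, ee_y0, ee_y1] at h4
  refine ⟨h4.1, h4.2, ?_⟩
  have h5 := congrArg (coeff (ee p q r s)) h3
  rw [coeff_E, coeff_smul, smul_eq_mul, ee_x0, ee_x1, ee_y0, ee_y1] at h5
  have h6 := mul_right_cancel₀ h h5
  have h7 : (p : ℂ) + r = q + s + j := by linear_combination h6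
  exact_mod_cast h7

lemma mdeg_mul {a b a' b' : ℕ} {f g : MvPolynomial II ℂ} (hf : f ∈ mdeg 2 ![1, 1] ![a, b])
    (hg : g ∈ mdeg 2 ![1, 1] ![a', b']) : f * g ∈ mdeg 2 ![1, 1] ![a + a', b + b'] := by
  classical
  rw [mem_mdeg] at *
  intro α hα
  have := support_mul f g (mem_support_iff.mpr hα)
  obtain ⟨β, hβ, γ, hγ, rfl⟩ := Finset.mem_add.mp this
  have h1 := hf β (mem_support_iff.mp hβ)
  have h2 := hg γ (mem_support_iff.mp hγ)
  simp only [Finsupp.add_apply]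
  omega

lemma mdeg_pow {a b : ℕ} {f : MvPolynomial II ℂ} (hf : f ∈ mdeg 2 ![1, 1] ![a, b]) (n : ℕ) :
    f ^ n ∈ mdeg 2 ![1, 1] ![n * a, n * b] := by
  classical
  induction n with
  | zero =>
    rw [mem_mdeg]
    intro α hα
    rw [pow_zero, coeff_one] at hα
    have : 0 = α := by by_contra h; simp [h] at hα
    subst this; simp
  | succ n ih =>
    rw [pow_succ, Nat.succ_mul, Nat.succ_mul]
    exact mdeg_mul ih hf

lemma mdeg_x (i : II) (hi : i = x0 ∨ i = x1) : X i ∈ mdeg 2 ![1, 1] ![1, 0] := by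
  classical
  rw [mem_mdeg]
  intro α hα
  rw [coeff_X] at hα
  have : Finsupp.single i 1 = α := by by_contra h; simp [h] at hα
  subst this
  rcases hi with rfl | rfl <;>
  simp [Finsupp.single_apply, ne01, ne02, ne03, ne12, ne13, ne01.symm]

lemma mdeg_y (i : II) (hi : i = y0 ∨ i = y1) : X i ∈ mdeg 2 ![1, 1] ![0, 1] := by
  classical
  rw [mem_mdeg]
  intro α hα
  rw [coeff_X] at hα
  have : Finsupp.single i 1 = α := by by_contra h; simp [h] at hα
  subst this
  rcases hi with rfl | rfl <;>
  simp [Finsupp.single_apply, ne02.symm, ne03.symm, ne12.symm, ne13.symm, ne23, ne23.symm]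

/-- The bracket invariant. -/
noncomputable def brk : MvPolynomial II ℂ := X x0 * X y1 - X x1 * X y0

lemma brk_mdeg : brk ∈ mdeg 2 ![1, 1] ![1, 1] := by
  refine Submodule.sub_mem _ ?_ ?_
  · exact mdeg_mul (mdeg_x _ (Or.inl rfl)) (mdeg_y _ (Or.inr rfl))
  · exact mdeg_mul (mdeg_x _ (Or.inr rfl)) (mdeg_y _ (Or.inl rfl))

lemma brk_D1 : D1 2 ![1, 1] brk = 0 := by
  simp only [brk, map_sub, Derivation.leibniz, D1_x0, D1_x1, D1_y0, D1_y1, smul_eq_mul]; ring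

lemma brk_E : E 2 ![1, 1] brk = 0 := by
  simp only [brk, map_sub, Derivation.leibniz, E_x0, E_x1, E_y0, E_y1, smul_eq_mul]; ring

lemma brk_ne : brk ≠ 0 := by
  intro h
  have := congrArg (eval (fun i => if i = x0 ∨ i = y1 then (1 : ℂ) else 0)) h
  simp [brk, ne01.symm, ne13] at this

lemma wit_mem (a b c : ℕ) : brk ^ c * (X x0 ^ a * X y0 ^ b) ∈ covS (c + a) (c + b) (a + b) := by
  rw [mem_covS]
  refine ⟨?_, ?_, ?_⟩
  · have := mdeg_mul (mdeg_pow brk_mdeg c) (mdeg_mul (mdeg_pow (mdeg_x x0 (Or.inl rfl)) a)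
      (mdeg_pow (mdeg_y y0 (Or.inl rfl)) b))
    simpa using this
  · simp [Derivation.leibniz, Derivation.leibniz_pow, brk_D1, D1_x0, D1_y0]
  · have hx : E 2 ![1, 1] (X x0 ^ a) = (a : ℂ) • X x0 ^ a := by
      rw [Derivation.leibniz_pow, E_x0]
      cases a with
      | zero => simp
      | succ a => simp [Nat.cast_smul_eq_nsmul, smul_eq_C_mul, pow_succ]
    have hy : E 2 ![1, 1] (X y0 ^ b) = (b : ℂ) • X y0 ^ b := by
      rw [Derivation.leibniz_pow, E_y0]
      cases b with
      | zero => simp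
      | succ a => simp [Nat.cast_smul_eq_nsmul, smul_eq_C_mul, pow_succ]
    rw [Derivation.leibniz, Derivation.leibniz_pow, brk_E, Derivation.leibniz, hx, hy]
    simp [smul_eq_C_mul]
    ring

lemma wit_ne (a b c : ℕ) : brk ^ c * (X x0 ^ a * X y0 ^ b) ≠ 0 :=
  mul_ne_zero (pow_ne_zero _ brk_ne)
    (mul_ne_zero (pow_ne_zero _ (X_ne_zero _)) (pow_ne_zero _ (X_ne_zero _)))

lemma finrank_one (a b c : ℕ) : Module.finrank ℂ (covS (c + a) (c + b) (a + b)) = 1 := by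
  let φ : covS (c + a) (c + b) (a + b) →ₗ[ℂ] ℂ :=
    (lcoeff ℂ (ee (c + a) 0 b c)).comp (Submodule.subtype _)
  have hφ : Function.Injective φ := by
    rw [injective_iff_map_eq_zero]
    rintro ⟨f, hf⟩ h
    have h' : coeff (ee (c + a) 0 b c) f = 0 := h
    have : f = 0 := by
      refine zero_of_base f ((mem_covS _ _ _ _).mp hf).2.1 ?_
      intro p r s
      by_contra hne
      have := supp_covS hf _ _ _ _ hne
      obtain ⟨rfl, rfl, rfl⟩ : p = c + a ∧ r = b ∧ s = c := by omega
      exact hne h'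
    exact Subtype.ext this
  have hfin : Module.Finite ℂ (covS (c + a) (c + b) (a + b)) := Module.Finite.of_injective φ hφ
  apply le_antisymm
  · simpa using LinearMap.finrank_le_finrank_of_injective hφ
  · have : Nontrivial (covS (c + a) (c + b) (a + b)) :=
      ⟨⟨_, wit_mem a b c⟩, 0, fun h => wit_ne a b c (congrArg Subtype.val h)⟩
    exact Module.finrank_pos

lemma finrank_zero (m₁ m₂ j : ℕ)
    (h : ¬ (j ≤ m₁ + m₂ ∧ m₁ ≤ m₂ + j ∧ m₂ ≤ m₁ + j ∧ (m₁ + m₂ + j) % 2 = 0)) :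
    Module.finrank ℂ (covS m₁ m₂ j) = 0 := by
  have : covS m₁ m₂ j = ⊥ := by
    rw [eq_bot_iff]
    intro f hf
    rw [Submodule.mem_bot]
    have hD := ((mem_covS _ _ _ _).mp hf).2.1
    refine zero_of_base f hD ?_
    intro p r s
    by_contra hne
    have h1 := supp_covS hf _ _ _ _ hne
    have h2 : ¬ p < s := fun hlt => hne (zero_of_lt f hD _ _ _ _ hlt)
    omega
  rw [this, finrank_bot]

/-- The multivariate Poincaré series of the algebra of joint covariants of two binary
linear forms is `1 / ((1 - z₁t)(1 - z₂t)(1 - z₁z₂))`: for `d = (1,1)`, the dimension of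
the space of multidegree-`(m₁, m₂)` polynomials with `D1 f = 0` and `E f = j • f` equals
the coefficient of `z₁^{m₁} z₂^{m₂} t^j` in that series.  The power-series variables are
indexed by `Fin 2 ⊕ Unit`, with `Sum.inl 0 ↦ z₁`, `Sum.inl 1 ↦ z₂`, `Sum.inr () ↦ t`;
the denominator has constant term `1`, hence is invertible. -/
theorem poincare_series_covariants_d11 (m₁ m₂ j : ℕ) :
    (Module.finrank ℂ ↥(mdeg 2 ![1, 1] ![m₁, m₂] ⊓
        LinearMap.ker (D1 2 ![1, 1]).toLinearMap ⊓
        Module.End.eigenspace ((E 2 ![1, 1]).toLinearMap) (j : ℂ)) : ℤ) =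
      MvPowerSeries.coeff (R := ℤ)
        (Finsupp.equivFunOnFinite.symm (Sum.elim ![m₁, m₂] fun _ => j))
        (MvPowerSeries.invOfUnit
          ((1 - MvPowerSeries.X (Sum.inl 0 : Fin 2 ⊕ Unit) *
              MvPowerSeries.X (Sum.inr ())) *
           (1 - MvPowerSeries.X (Sum.inl 1 : Fin 2 ⊕ Unit) *
              MvPowerSeries.X (Sum.inr ())) *
           (1 - MvPowerSeries.X (Sum.inl 0 : Fin 2 ⊕ Unit) *
              MvPowerSeries.X (Sum.inl 1))) 1) := by
  classical
  rw [inv_eq_indPS, coeff_indPS]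
  change (Module.finrank ℂ (covS m₁ m₂ j) : ℤ) =
    @ite ℤ (j ≤ m₁ + m₂ ∧ m₁ ≤ m₂ + j ∧ m₂ ≤ m₁ + j ∧ (m₁ + m₂ + j) % 2 = 0)
      (Classical.propDecidable _) 1 0
  split_ifs with h
  · obtain ⟨a, b, c, rfl, rfl, rfl⟩ : ∃ a b c, m₁ = c + a ∧ m₂ = c + b ∧ j = a + b :=
      ⟨m₁ - (m₁ + m₂ - j) / 2, m₂ - (m₁ + m₂ - j) / 2, (m₁ + m₂ - j) / 2,
        by omega, by omega, by omega⟩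
    rw [finrank_one]; rfl
  · rw [finrank_zero _ _ _ h]; rfl
end
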